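/- arXiv:1311.5883 — 2 statements merged into one kernel-verified Lean document; each statement's English description precedes it below -/
import Mathlib

section
/- Let U be an update family such that the origin belongs to the closed convex hull in ℝ² of every update rule X_i. Then for every p < 1, ℙ_p([A] = ℤ²) = 0; in particular p_c(ℤ², U) = 1. -/
open Set MeasureTheory

/-- A site of the two-dimensional lattice. -/
abbrev Site : Type := ℤ × ℤ

/-- One step of the `U`-bootstrap process. -/
def bsStep (U : Finset (Finset Site)) (A : Set Site) : Set Site :=
  A ∪ {x : Site | ∃ X ∈ U, ∀ y ∈ X, y + x ∈ A}

/-- The `t`-th stage of the `U`-bootstrap process started from `A`. -/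
def bsIter (U : Finset (Finset Site)) : ℕ → Set Site → Set Site
  | 0, A => A
  | n + 1, A => bsStep U (bsIter U n A)

/-- The closure `[A]` under the `U`-bootstrap process. -/
def bsClosure (U : Finset (Finset Site)) (A : Set Site) : Set Site :=
  ⋃ n : ℕ, bsIter U n A

/-- `U` is an update family: a (finite) collection of finite nonempty subsets of `ℤ² \ {0}`. -/
def IsUpdateFamily (U : Finset (Finset Site)) : Prop :=
  U.Nonempty ∧ ∀ X ∈ U, X.Nonempty ∧ (0 : Site) ∉ X

/-- The discrete half-plane `H_u` determined by `u ∈ ℝ²`. -/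
def halfPlane (u : ℝ × ℝ) : Set Site :=
  {x : Site | (x.1 : ℝ) * u.1 + (x.2 : ℝ) * u.2 < 0}

/-- A direction `u` is stable for `U` if `[H_u] = H_u`. -/
def IsStableDir (U : Finset (Finset Site)) (u : ℝ × ℝ) : Prop :=
  bsClosure U (halfPlane u) = halfPlane u

/-- The unit vector of angle `θ`. -/
noncomputable def dir (θ : ℝ) : ℝ × ℝ := (Real.cos θ, Real.sin θ)

/-- `dir θ` lies in the interior of the stable set (is strongly stable). -/
def IsStronglyStableAngle (U : Finset (Finset Site)) (θ : ℝ) : Prop :=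
  ∃ ε > 0, ∀ φ : ℝ, |φ - θ| < ε → IsStableDir U (dir φ)

/-- `U` is subcritical: every open semicircle contains a strongly stable direction. -/
def Subcritical (U : Finset (Finset Site)) : Prop :=
  ∀ θ : ℝ, ∃ φ : ℝ, θ < φ ∧ φ < θ + Real.pi ∧ IsStronglyStableAngle U φ

/-- `U` is supercritical: some open semicircle contains no stable direction. -/
def Supercritical (U : Finset (Finset Site)) : Prop :=
  ∃ θ : ℝ, ∀ φ : ℝ, θ < φ → φ < θ + Real.pi → ¬ IsStableDir U (dir φ)

/-- The random set of infected sites determined by `ω`. -/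
def siteSet (ω : Site → Bool) : Set Site := {x : Site | ω x = true}

/-- `μ` is the Bernoulli product measure with density `p` on `ℤ²`:
each site lies in the random set independently with probability `p`. -/
def IsBernoulli (p : ℝ) (μ : Measure (Site → Bool)) : Prop :=
  ∀ (s : Finset Site) (f : Site → Bool),
    μ {ω : Site → Bool | ∀ x ∈ s, ω x = f x}
      = ∏ x ∈ s, ENNReal.ofReal (if f x then p else 1 - p)

/-- `A` percolates: its closure is all of `ℤ²`. -/
def Percolates (U : Finset (Finset Site)) (A : Set Site) : Prop :=
  bsClosure U A = Set.univ

/-- The critical probability `p_c(ℤ², U)`. -/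
noncomputable def critProb (U : Finset (Finset Site)) : ℝ :=
  sInf {p : ℝ | p ∈ Set.Icc (0 : ℝ) 1 ∧
    ∀ μ : Measure (Site → Bool), IsBernoulli p μ →
      μ {ω : Site → Bool | Percolates U (siteSet ω)} = 1}

/-- Euclidean embedding of the lattice into the complex plane. -/
noncomputable def toC (v : Site) : ℂ := ⟨(v.1 : ℝ), (v.2 : ℝ)⟩

/-- The range `r(U)`: the largest Euclidean distance between two sites of one update rule. -/
noncomputable def famRange (U : Finset (Finset Site)) : ℝ :=
  (U.sup fun X => X.sup fun a => X.sup fun b => nndist (toC a) (toC b) : NNReal)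

/-- The lattice points of the zonotope `∑_{g ∈ G} [0, 2] g`. -/
def zonotopeSites (G : Finset Site) : Set Site :=
  {x : Site | ∃ c : Site → ℝ, (∀ g ∈ G, 0 ≤ c g ∧ c g ≤ 2) ∧
    ∑ g ∈ G, c g * (g.1 : ℝ) = x.1 ∧ ∑ g ∈ G, c g * (g.2 : ℝ) = x.2}

lemma zero_mem_zonotopeSites (G : Finset Site) : (0 : Site) ∈ zonotopeSites G :=
  ⟨0, by simp, by simp, by simp⟩

lemma zonotopeSites_bounded (G : Finset Site) :
    ∃ M : ℕ, ∀ x ∈ zonotopeSites G, |x.1| ≤ M ∧ |x.2| ≤ M := by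
  have key : ∀ (c : Site → ℝ) (f : Site → ℤ) (z : ℤ), (∀ g ∈ G, 0 ≤ c g ∧ c g ≤ 2) →
      ∑ g ∈ G, c g * (f g : ℝ) = z → |z| ≤ ∑ g ∈ G, 2 * |f g| := by
    intro c f z hc hz
    have h : |(z : ℝ)| ≤ ∑ g ∈ G, 2 * |(f g : ℝ)| := by
      rw [← hz]
      refine (Finset.abs_sum_le_sum_abs _ _).trans (Finset.sum_le_sum fun g hg => ?_)
      rw [abs_mul, abs_of_nonneg (hc g hg).1]
      exact mul_le_mul_of_nonneg_right (hc g hg).2 (abs_nonneg _)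
    exact_mod_cast h
  refine ⟨(max (∑ g ∈ G, 2 * |g.1|) (∑ g ∈ G, 2 * |g.2|)).toNat, ?_⟩
  rintro x ⟨c, hc, h1, h2⟩
  have a := key c Prod.fst x.1 hc h1
  have b := key c Prod.snd x.2 hc h2
  constructor <;> omega

lemma add_mem_zonotopeSites {G : Finset Site} {x y : Site} (hy : y ∈ G) (c : Site → ℝ)
    (hc : ∀ g ∈ G, 0 ≤ c g ∧ c g ≤ 2) (hcy : c y ≤ 1)
    (h1 : ∑ g ∈ G, c g * (g.1 : ℝ) = x.1) (h2 : ∑ g ∈ G, c g * (g.2 : ℝ) = x.2) :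
    y + x ∈ zonotopeSites G := by
  refine ⟨fun g => c g + if g = y then 1 else 0, fun g hg => ?_, ?_, ?_⟩
  · have := hc g hg
    dsimp only
    split_ifs with h
    · subst h
      constructor <;> linarith
    · simpa using this
  · simp [add_mul, Finset.sum_add_distrib, h1, hy, add_comm]
  · simp [add_mul, Finset.sum_add_distrib, h2, hy, add_comm]

/-- If the origin is a convex combination of the sites of `X ⊆ G`, then every translate of `X` by a
site of the zonotope of `G` meets that zonotope. -/
lemma exists_add_mem_zonotopeSites {G X : Finset Site} (hXG : X ⊆ G) (w : Site → ℝ)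
    (hw : ∀ y ∈ X, 0 ≤ w y) (hw1 : ∑ y ∈ X, w y = 1)
    (hfst : ∑ y ∈ X, w y * (y.1 : ℝ) = 0) (hsnd : ∑ y ∈ X, w y * (y.2 : ℝ) = 0)
    {x : Site} (hx : x ∈ zonotopeSites G) : ∃ y ∈ X, y + x ∈ zonotopeSites G := by
  obtain ⟨c, hc, h1, h2⟩ := hx
  by_cases h : ∃ y ∈ X, c y ≤ 1
  · obtain ⟨y, hy, hcy⟩ := h
    exact ⟨y, hy, add_mem_zonotopeSites (hXG hy) c hc hcy h1 h2⟩
  push Not at h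
  have hne : X.Nonempty := by
    rw [Finset.nonempty_iff_ne_empty]
    rintro rfl
    simp at hw1
  obtain ⟨z, hz, hmax⟩ := Finset.exists_max_image X w hne
  have hzpos : 0 < w z := by
    by_contra! hneg
    have := Finset.sum_nonpos fun y hy => (hmax y hy).trans hneg
    linarith
  have hshift : ∀ f : Site → ℝ, ∑ y ∈ X, w y * f y = 0 →
      ∑ g ∈ G, (c g - if g ∈ X then w g / w z else 0) * f g = ∑ g ∈ G, c g * f g := by
    intro f hf
    have : ∑ g ∈ G, (if g ∈ X then w g / w z else 0) * f g = 0 := by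
      calc _ = ∑ g ∈ G, if g ∈ X then w g / w z * f g else 0 := by simp [ite_mul]
        _ = ∑ g ∈ X, w g / w z * f g := by
          rw [← Finset.sum_filter, Finset.filter_mem_eq_inter, Finset.inter_eq_right.2 hXG]
        _ = (∑ g ∈ X, w g * f g) / w z := by
          rw [Finset.sum_div]
          exact Finset.sum_congr rfl fun g _ => by ring
        _ = 0 := by rw [hf, zero_div]
    simp only [sub_mul, Finset.sum_sub_distrib, this, sub_zero]
  refine ⟨z, hz, add_mem_zonotopeSites (hXG hz)
    (fun g => c g - if g ∈ X then w g / w z else 0) (fun g hg => ?_) ?_ ?_ ?_⟩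
  · have := hc g hg
    split_ifs with hgX
    · have h3 := h g hgX
      have h4 : w g / w z ≤ 1 := (div_le_one hzpos).2 (hmax g hgX)
      have h5 : 0 ≤ w g / w z := div_nonneg (hw g hgX) hzpos.le
      constructor <;> linarith
    · simpa using this
  · have := (hc z (hXG hz)).2
    simp only [hz, if_true, div_self hzpos.ne']
    linarith
  · rw [hshift _ hfst, h1]
  · rw [hshift _ hsnd, h2]

lemma exists_weights_of_zero_mem_convexHull {X : Finset Site}
    (h : (0 : ℝ × ℝ) ∈
      convexHull ℝ ((fun v : Site => ((v.1 : ℝ), (v.2 : ℝ))) '' (X : Set Site))) :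
    ∃ w : Site → ℝ, (∀ y ∈ X, 0 ≤ w y) ∧ ∑ y ∈ X, w y = 1 ∧
      ∑ y ∈ X, w y * (y.1 : ℝ) = 0 ∧ ∑ y ∈ X, w y * (y.2 : ℝ) = 0 := by
  have hinj : Function.Injective (fun v : Site => ((v.1 : ℝ), (v.2 : ℝ))) := by
    rintro ⟨a, b⟩ ⟨c, d⟩ hab
    simpa using hab
  rw [← Finset.coe_image, Finset.mem_convexHull'] at h
  obtain ⟨w, hw, hw1, hw0⟩ := h
  rw [Finset.sum_image hinj.injOn] at hw1 hw0
  refine ⟨fun v => w ((v.1 : ℝ), (v.2 : ℝ)), fun y hy => hw _ (Finset.mem_image_of_mem _ hy),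
    hw1, ?_, ?_⟩
  · simpa [Prod.fst_sum] using congrArg Prod.fst hw0
  · simpa [Prod.snd_sum] using congrArg Prod.snd hw0

/-- A set of healthy sites that meets each of its translated rules stays healthy forever. -/
lemma disjoint_bsClosure {U : Finset (Finset Site)} {A K : Set Site} (hA : Disjoint A K)
    (hK : ∀ X ∈ U, ∀ x ∈ K, ∃ y ∈ X, y + x ∈ K) : Disjoint (bsClosure U A) K := by
  rw [bsClosure, Set.disjoint_iUnion_left]
  intro n
  induction n with
  | zero => exact hA
  | succ n ih =>
    rw [bsIter, bsStep, Set.disjoint_union_left]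
    refine ⟨ih, Set.disjoint_left.2 ?_⟩
    rintro x ⟨X, hX, hx⟩ hxK
    obtain ⟨y, hy, hyx⟩ := hK X hX x hxK
    exact Set.disjoint_left.1 ih (hx y hy) hyx

lemma IsBernoulli.isProbabilityMeasure {p : ℝ} {μ : Measure (Site → Bool)}
    (h : IsBernoulli p μ) : IsProbabilityMeasure μ :=
  ⟨by simpa using h ∅ fun _ => true⟩

/-- The configurations with no infected site in `T`. -/
def healthyOn (T : Finset Site) : Set (Site → Bool) := {ω | ∀ x ∈ T, ω x = false}

lemma measurableSet_healthyOn (T : Finset Site) : MeasurableSet (healthyOn T) := by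
  have : healthyOn T = ⋂ x ∈ T, (fun ω : Site → Bool => ω x) ⁻¹' {false} := by
    ext ω
    simp [healthyOn]
  rw [this]
  exact Finset.measurableSet_biInter _ fun x _ => measurable_pi_apply x (measurableSet_singleton _)

lemma IsBernoulli.measureReal_healthyOn {p : ℝ} (hp : p ≤ 1) {μ : Measure (Site → Bool)}
    (h : IsBernoulli p μ) (T : Finset Site) : μ.real (healthyOn T) = (1 - p) ^ T.card := by
  have := h T fun _ => false
  simp only [Bool.false_eq_true, if_false, Finset.prod_const] at this
  rw [measureReal_def, healthyOn, this, ENNReal.toReal_pow, ENNReal.toReal_ofReal (by linarith)]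

/-- Disjoint sets of sites of the same cardinality meet the infected set independently. -/
lemma IsBernoulli.measureReal_healthyOn_diff {p : ℝ} (hp : p ≤ 1) {μ : Measure (Site → Bool)}
    (h : IsBernoulli p μ) {K : ℕ → Finset Site} (hK : Pairwise fun i j => Disjoint (K i) (K j))
    {k : ℕ} (hk : ∀ i, (K i).card = k) (n : ℕ) (T : Finset Site)
    (hT : ∀ i < n, Disjoint T (K i)) :
    μ.real (healthyOn T \ ⋃ i ∈ Finset.range n, healthyOn (K i))
      = (1 - p) ^ T.card * (1 - (1 - p) ^ k) ^ n := by
  have := h.isProbabilityMeasure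
  induction n generalizing T with
  | zero => simpa using h.measureReal_healthyOn hp T
  | succ n ih =>
    have hTn : Disjoint T (K n) := hT n (Nat.lt_succ_self n)
    have e : healthyOn T \ ⋃ i ∈ Finset.range (n + 1), healthyOn (K i)
        = (healthyOn T \ ⋃ i ∈ Finset.range n, healthyOn (K i)) \
          (healthyOn (T ∪ K n) \ ⋃ i ∈ Finset.range n, healthyOn (K i)) := by
      have hu : healthyOn (T ∪ K n) = healthyOn T ∩ healthyOn (K n) := by
        ext ω
        simp only [healthyOn, Finset.mem_union, Set.mem_ofPred_eq, Set.mem_inter_iff, or_imp,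
          forall_and]
      rw [Finset.range_add_one, Finset.set_biUnion_insert, hu]
      ext ω
      simp only [Set.mem_sdiff, Set.mem_union, Set.mem_inter_iff]
      tauto
    have hmeas : ∀ S : Finset Site,
        MeasurableSet (healthyOn S \ ⋃ i ∈ Finset.range n, healthyOn (K i)) := fun S =>
      (measurableSet_healthyOn S).diff
        (Finset.measurableSet_biUnion _ fun i _ => measurableSet_healthyOn _)
    have hsub : healthyOn (T ∪ K n) ⊆ healthyOn T := fun ω hω x hx =>
      hω x (Finset.mem_union_left _ hx)
    rw [e, measureReal_sdiff (Set.sdiff_subset_sdiff_left hsub) (hmeas _),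
      ih T fun i hi => hT i (hi.trans (Nat.lt_succ_self n)), ih (T ∪ K n) fun i hi => ?_,
      Finset.card_union_of_disjoint hTn, hk]
    · ring
    · exact Finset.disjoint_union_left.2 ⟨hT i (hi.trans (Nat.lt_succ_self n)), hK hi.ne'⟩

/-- Almost surely, some member of an infinite disjoint family of sets of the same cardinality
contains no infected site. -/
lemma IsBernoulli.measure_forall_not_healthyOn {p : ℝ} (hp0 : 0 ≤ p) (hp : p < 1)
    {μ : Measure (Site → Bool)} (h : IsBernoulli p μ) {K : ℕ → Finset Site}
    (hK : Pairwise fun i j => Disjoint (K i) (K j)) {k : ℕ} (hk : ∀ i, (K i).card = k) :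
    μ {ω | ∀ i, ω ∉ healthyOn (K i)} = 0 := by
  have := h.isProbabilityMeasure
  rw [← measureReal_eq_zero_iff]
  have hle : ∀ n : ℕ, μ.real {ω | ∀ i, ω ∉ healthyOn (K i)} ≤ (1 - (1 - p) ^ k) ^ n := by
    intro n
    have e := h.measureReal_healthyOn_diff hp.le hK hk n ∅ (by simp)
    rw [Finset.card_empty, pow_zero, one_mul] at e
    rw [← e]
    refine measureReal_mono fun ω hω => ⟨by simp [healthyOn], ?_⟩
    simpa using fun i _ => hω i
  have hpos : 0 < (1 - p) ^ k := pow_pos (by linarith) k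
  have hle1 : (1 - p) ^ k ≤ 1 := pow_le_one₀ (by linarith) (by linarith)
  exact le_antisymm (ge_of_tendsto'
    (tendsto_pow_atTop_nhds_zero_of_lt_one (by linarith) (by linarith)) hle) measureReal_nonneg

lemma IsBernoulli.measure_percolates_eq_zero {U : Finset (Finset Site)}
    (hhull : ∀ X ∈ U,
        (0 : ℝ × ℝ) ∈ convexHull ℝ ((fun v : Site => ((v.1 : ℝ), (v.2 : ℝ))) '' (X : Set Site)))
    {p : ℝ} (hp0 : 0 ≤ p) (hp : p < 1) {μ : Measure (Site → Bool)} (h : IsBernoulli p μ) :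
    μ {ω : Site → Bool | Percolates U (siteSet ω)} = 0 := by
  set G : Finset Site := U.sup id
  obtain ⟨M, hM⟩ := zonotopeSites_bounded G
  have hfin : (zonotopeSites G).Finite := by
    refine ((Set.finite_Icc (-(M : ℤ)) M).prod (Set.finite_Icc (-(M : ℤ)) M)).subset ?_
    intro x hx
    exact ⟨abs_le.1 (hM x hx).1, abs_le.1 (hM x hx).2⟩
  let s : ℕ → Site := fun i => (((i * (2 * M + 1) : ℕ) : ℤ), 0)
  let K : ℕ → Finset Site := fun i => hfin.toFinset.map (addRightEmbedding (s i))
  have memK : ∀ i x, x ∈ K i ↔ ∃ z ∈ zonotopeSites G, z + s i = x := by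
    intro i x
    simp [K]
  have hdisj : Pairwise fun i j => Disjoint (K i) (K j) := by
    intro i j hij
    rw [Finset.disjoint_left]
    intro x hxi hxj
    obtain ⟨a, ha, rfl⟩ := (memK i x).1 hxi
    obtain ⟨b, hb, hab⟩ := (memK j _).1 hxj
    have e : b.1 + (j : ℤ) * (2 * M + 1) = a.1 + (i : ℤ) * (2 * M + 1) := by
      simpa [s] using congrArg Prod.fst hab
    have ha := abs_le.1 (hM a ha).1
    have hb := abs_le.1 (hM b hb).1
    rcases lt_or_gt_of_ne hij with hlt | hlt
    · have : (i : ℤ) + 1 ≤ j := by exact_mod_cast hlt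
      nlinarith
    · have : (j : ℤ) + 1 ≤ i := by exact_mod_cast hlt
      nlinarith
  refine measure_mono_null (fun ω hω => ?_)
    (h.measure_forall_not_healthyOn hp0 hp hdisj fun i => Finset.card_map _)
  rw [Set.mem_ofPred_eq]
  intro i hi
  have hA : Disjoint (siteSet ω) (K i : Set Site) := by
    rw [Set.disjoint_left]
    intro x hx hxK
    have hf := hi x hxK
    rw [siteSet, Set.mem_ofPred_eq, hf] at hx
    exact Bool.false_ne_true hx
  have hstable : ∀ X ∈ U, ∀ x ∈ (K i : Set Site), ∃ y ∈ X, y + x ∈ (K i : Set Site) := by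
    intro X hX x hx
    obtain ⟨z, hz, rfl⟩ := (memK i x).1 hx
    obtain ⟨w, hw, hw1, hfst, hsnd⟩ := exists_weights_of_zero_mem_convexHull (hhull X hX)
    obtain ⟨y, hy, hyz⟩ := exists_add_mem_zonotopeSites
      (show X ⊆ G from Finset.le_sup (f := id) hX) w hw hw1 hfst hsnd hz
    exact ⟨y, hy, (memK i _).2 ⟨y + z, hyz, add_assoc _ _ _⟩⟩
  have hd := disjoint_bsClosure hA hstable
  rw [show bsClosure U (siteSet ω) = Set.univ from hω, Set.univ_disjoint] at hd
  have : 0 + s i ∈ (K i : Set Site) := (memK i _).2 ⟨0, zero_mem_zonotopeSites G, rfl⟩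
  simp [hd] at this

lemma IsBernoulli.measure_percolates_eq_one (U : Finset (Finset Site))
    {μ : Measure (Site → Bool)} (h : IsBernoulli 1 μ) :
    μ {ω : Site → Bool | Percolates U (siteSet ω)} = 1 := by
  have := h.isProbabilityMeasure
  have hsite : ∀ x : Site, ∀ᵐ ω ∂μ, ω x = true := by
    intro x
    have hx : μ {ω | ω x = false} = 0 := by simpa using h {x} fun _ => false
    simpa [ae_iff] using hx
  have hall : ∀ᵐ ω ∂μ, Percolates U (siteSet ω) := by
    filter_upwards [ae_all_iff.2 hsite] with ω hω
    exact Set.eq_univ_of_forall fun x => Set.mem_iUnion.2 ⟨0, hω x⟩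
  rw [measure_congr (Filter.eventuallyEq_univ.2 hall), measure_univ]

lemma exists_isBernoulli {p : ℝ} (hp0 : 0 ≤ p) (hp : p ≤ 1) :
    ∃ μ : Measure (Site → Bool), IsBernoulli p μ := by
  let ν : Measure Bool := ENNReal.ofReal p • Measure.dirac true +
    ENNReal.ofReal (1 - p) • Measure.dirac false
  have hν : IsProbabilityMeasure ν := by
    refine ⟨?_⟩
    simp [ν, ← ENNReal.ofReal_add hp0 (sub_nonneg.2 hp)]
  refine ⟨Measure.infinitePi fun _ => ν, fun s f => ?_⟩
  have e : {ω : Site → Bool | ∀ x ∈ s, ω x = f x} = Set.pi s fun x => {f x} := by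
    ext ω
    simp [Set.mem_pi]
  rw [e, Measure.infinitePi_pi _ fun x _ => measurableSet_singleton _]
  refine Finset.prod_congr rfl fun x _ => ?_
  cases f x <;> simp [ν]

/-- Let `U` be an update family such that the origin belongs to the
closed convex hull (in `ℝ²`) of every update rule. Then for every `p < 1` we have
`ℙ_p([A] = ℤ²) = 0`; in particular `p_c(ℤ², U) = 1`. -/
theorem critProb_eq_one_of_zero_mem_hulls
    (U : Finset (Finset Site)) (hU : IsUpdateFamily U)
    (hhull : ∀ X ∈ U,
        (0 : ℝ × ℝ) ∈ convexHull ℝ ((fun v : Site => ((v.1 : ℝ), (v.2 : ℝ))) '' (X : Set Site))) :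
    (∀ p : ℝ, 0 ≤ p → p < 1 → ∀ μ : Measure (Site → Bool), IsBernoulli p μ →
        μ {ω : Site → Bool | Percolates U (siteSet ω)} = 0) ∧
    critProb U = 1 := by
  refine ⟨fun p hp0 hp μ h => h.measure_percolates_eq_zero hhull hp0 hp, ?_⟩
  have hset : {p : ℝ | p ∈ Set.Icc (0 : ℝ) 1 ∧ ∀ μ : Measure (Site → Bool), IsBernoulli p μ →
      μ {ω : Site → Bool | Percolates U (siteSet ω)} = 1} = {1} := by
    ext p
    rw [Set.mem_ofPred_eq, Set.mem_singleton_iff]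
    constructor
    · rintro ⟨⟨hp0, hp1⟩, hperc⟩
      by_contra hne
      obtain ⟨μ, h⟩ := exists_isBernoulli hp0 hp1
      have h1 := hperc μ h
      rw [h.measure_percolates_eq_zero hhull hp0 (lt_of_le_of_ne hp1 hne)] at h1
      exact zero_ne_one h1
    · rintro rfl
      exact ⟨⟨zero_le_one, le_rfl⟩, fun μ h => h.measure_percolates_eq_one U⟩
  rw [critProb, hset, csInf_singleton]
end

section
/- Let u_1, u_2, u_3 ∈ S¹ be distinct directions and λ_1, λ_2, λ_3 > 0 with λ_1u_1 + λ_2u_2 + λ_3u_3 = 0, and for u ∈ S¹ and a ∈ ℝ² let H_{u,a} = {x ∈ ℤ² : ⟨x − a, u⟩ < 0}. Then for all a_1, a_2, a_3 ∈ ℝ², the set ⋂_{i=1}^{3} H_{u_i,a_i} is finite. Moreover, if each u_i is a stable direction for an update family U, then [⋂_{i=1}^{3} H_{u_i,a_i}] = ⋂_{i=1}^{3} H_{u_i,a_i}, i.e. this set is closed under U. -/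
open Set MeasureTheory

/-- The shifted discrete half-plane `H_{u,a} = {x ∈ ℤ² : ⟨x − a, u⟩ < 0}`. -/
def shiftedHalfPlane (u a : ℝ × ℝ) : Set Site :=
  {x : Site | ((x.1 : ℝ) - a.1) * u.1 + ((x.2 : ℝ) - a.2) * u.2 < 0}

/-- If `u` is stable, no rule is contained in the half-plane `H_u`. -/
theorem not_subset_halfPlane_of_isStableDir {U : Finset (Finset Site)} {u : ℝ × ℝ}
    (hu : IsStableDir U u) {X : Finset Site} (hX : X ∈ U) : ¬ ∀ y ∈ X, y ∈ halfPlane u := by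
  intro h
  have h0 : (0 : Site) ∈ bsClosure U (halfPlane u) :=
    mem_iUnion.2 ⟨1, Or.inr ⟨X, hX, fun y hy => by simpa [bsIter] using h y hy⟩⟩
  rw [hu] at h0
  simp [halfPlane] at h0

/-- In a stable direction, a rule contained in `H_{u,a}` only infects sites of `H_{u,a}`. -/
theorem mem_shiftedHalfPlane_of_isStableDir {U : Finset (Finset Site)} {u : ℝ × ℝ}
    (hu : IsStableDir U u) (a : ℝ × ℝ) {X : Finset Site} (hX : X ∈ U) {x : Site}
    (h : ∀ y ∈ X, y + x ∈ shiftedHalfPlane u a) : x ∈ shiftedHalfPlane u a := by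
  by_contra hx
  refine not_subset_halfPlane_of_isStableDir hu hX fun y hy => ?_
  have hyx := h y hy
  simp only [shiftedHalfPlane, halfPlane, mem_ofPred_eq, Prod.fst_add, Prod.snd_add,
    Int.cast_add, not_lt] at hx hyx ⊢
  linarith

/-- A set to which no rule adds a site is its own closure. -/
theorem bsClosure_eq_self {U : Finset (Finset Site)} {A : Set Site}
    (h : ∀ X ∈ U, ∀ x, (∀ y ∈ X, y + x ∈ A) → x ∈ A) : bsClosure U A = A := by
  have hstep : bsStep U A = A :=
    union_eq_self_of_subset_right fun x ⟨X, hX, hx⟩ => h X hX x hx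
  have hiter (n : ℕ) : bsIter U n A = A := by
    induction n with
    | zero => rfl
    | succ n ih => rw [bsIter, ih, hstep]
  simp [bsClosure, hiter, iUnion_const]

/-- Lattice points on which two linearly independent linear forms are bounded are finite
in number. -/
theorem finite_setOf_abs_le {u v : ℝ × ℝ} (hd : u.1 * v.2 - u.2 * v.1 ≠ 0) (M N : ℝ) :
    {x : Site | |(x.1 : ℝ) * u.1 + x.2 * u.2| ≤ M ∧
      |(x.1 : ℝ) * v.1 + x.2 * v.2| ≤ N}.Finite := by
  set d := u.1 * v.2 - u.2 * v.1
  have hd' : 0 < |d| := abs_pos.2 hd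
  set R₁ := (M * |v.2| + N * |u.2|) / |d|
  set R₂ := (N * |u.1| + M * |v.1|) / |d|
  refine ((finite_Icc (-⌈R₁⌉) ⌈R₁⌉).prod (finite_Icc (-⌈R₂⌉) ⌈R₂⌉)).subset ?_
  rintro ⟨m, n⟩ ⟨hu, hv⟩
  dsimp only at hu hv
  have bound {a b p q M N : ℝ} (ha : |a| ≤ M) (hb : |b| ≤ N) :
      |a * p - b * q| ≤ M * |p| + N * |q| := by
    refine (abs_sub _ _).trans ?_
    rw [abs_mul, abs_mul]
    gcongr
  have hm : |(m : ℝ)| ≤ R₁ := by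
    rw [le_div_iff₀ hd', ← abs_mul]
    calc |(m : ℝ) * d| = |(m * u.1 + n * u.2) * v.2 - (m * v.1 + n * v.2) * u.2| := by
          congr 1; ring
      _ ≤ _ := bound hu hv
  have hn : |(n : ℝ)| ≤ R₂ := by
    rw [le_div_iff₀ hd', ← abs_mul]
    calc |(n : ℝ) * d| = |(m * v.1 + n * v.2) * u.1 - (m * u.1 + n * u.2) * v.1| := by
          congr 1; ring
      _ ≤ _ := bound hv hu
  have cast_bound {k : ℤ} {R : ℝ} (hk : |(k : ℝ)| ≤ R) : k ∈ Icc (-⌈R⌉) ⌈R⌉ := by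
    rw [mem_Icc, ← abs_le]
    exact_mod_cast hk.trans (Int.le_ceil R)
  exact ⟨cast_bound hm, cast_bound hn⟩

/-- Two of three distinct unit vectors with a vanishing positive combination are linearly
independent. -/
theorem det_ne_zero_of_positive_combination {u₁ u₂ u₃ : ℝ × ℝ}
    (hu₁ : u₁.1 ^ 2 + u₁.2 ^ 2 = 1) (hu₂ : u₂.1 ^ 2 + u₂.2 ^ 2 = 1)
    (hu₃ : u₃.1 ^ 2 + u₃.2 ^ 2 = 1) (h₁₂ : u₁ ≠ u₂) (h₂₃ : u₂ ≠ u₃) (h₃₁ : u₃ ≠ u₁)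
    {l₁ l₂ l₃ : ℝ} (hl₃ : 0 < l₃) (hsum : l₁ • u₁ + l₂ • u₂ + l₃ • u₃ = (0 : ℝ × ℝ)) :
    u₁.1 * u₂.2 - u₁.2 * u₂.1 ≠ 0 := by
  intro hd
  have unit_parallel {u v : ℝ × ℝ} (hu : u.1 ^ 2 + u.2 ^ 2 = 1) (hv : v.1 ^ 2 + v.2 ^ 2 = 1)
      (h : u.1 * v.2 - u.2 * v.1 = 0) (hne : u ≠ v) : v = -u := by
    set c := u.1 * v.1 + u.2 * v.2
    have h₁ : v.1 = c * u.1 := by linear_combination (-v.1) * hu - u.2 * h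
    have h₂ : v.2 = c * u.2 := by linear_combination (-v.2) * hu + u.1 * h
    have hc : (c - 1) * (c + 1) = 0 := by
      rw [h₁, h₂] at hv
      linear_combination hv - c ^ 2 * hu
    rcases mul_eq_zero.1 hc with hc | hc
    · rw [sub_eq_zero.1 hc, one_mul] at h₁ h₂
      exact absurd (Prod.ext h₁.symm h₂.symm) hne
    · rw [eq_neg_of_add_eq_zero_left hc, neg_one_mul] at h₁ h₂
      exact Prod.ext h₁ h₂
  have h₂ := unit_parallel hu₁ hu₂ hd h₁₂
  have e₁ : l₁ * u₁.1 + l₂ * u₂.1 + l₃ * u₃.1 = 0 := congrArg Prod.fst hsum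
  have e₂ : l₁ * u₁.2 + l₂ * u₂.2 + l₃ * u₃.2 = 0 := congrArg Prod.snd hsum
  have hd₃ : u₁.1 * u₃.2 - u₁.2 * u₃.1 = 0 := by
    refine (mul_eq_zero.1 ?_).resolve_left hl₃.ne'
    linear_combination u₁.1 * e₂ - u₁.2 * e₁ - l₂ * hd
  exact h₂₃ (h₂.trans (unit_parallel hu₁ hu₃ hd₃ h₃₁.symm).symm)

/-- If `u₁, u₂, u₃ ∈ S¹` are distinct and `λ₁u₁ + λ₂u₂ + λ₃u₃ = 0` with
`λ₁, λ₂, λ₃ > 0`, then for all `a₁, a₂, a₃ ∈ ℝ²` the set `⋂ H_{uᵢ,aᵢ}` is finite; moreover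
if each `uᵢ` is a stable direction for an update family `U`, this set is closed under `U`. -/
theorem triangle_of_halfPlanes_finite_and_closed
    (U : Finset (Finset Site)) (hU : IsUpdateFamily U)
    (u₁ u₂ u₃ : ℝ × ℝ)
    (hu₁ : u₁.1 ^ 2 + u₁.2 ^ 2 = 1) (hu₂ : u₂.1 ^ 2 + u₂.2 ^ 2 = 1)
    (hu₃ : u₃.1 ^ 2 + u₃.2 ^ 2 = 1)
    (hne : u₁ ≠ u₂ ∧ u₂ ≠ u₃ ∧ u₃ ≠ u₁)
    (lam₁ lam₂ lam₃ : ℝ) (hpos : 0 < lam₁ ∧ 0 < lam₂ ∧ 0 < lam₃)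
    (hsum : lam₁ • u₁ + lam₂ • u₂ + lam₃ • u₃ = (0 : ℝ × ℝ))
    (a₁ a₂ a₃ : ℝ × ℝ) :
    (shiftedHalfPlane u₁ a₁ ∩ shiftedHalfPlane u₂ a₂ ∩ shiftedHalfPlane u₃ a₃).Finite ∧
    ((IsStableDir U u₁ ∧ IsStableDir U u₂ ∧ IsStableDir U u₃) →
      bsClosure U (shiftedHalfPlane u₁ a₁ ∩ shiftedHalfPlane u₂ a₂ ∩ shiftedHalfPlane u₃ a₃)
        = shiftedHalfPlane u₁ a₁ ∩ shiftedHalfPlane u₂ a₂ ∩ shiftedHalfPlane u₃ a₃) := by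
  obtain ⟨h₁₂, h₂₃, h₃₁⟩ := hne
  obtain ⟨hl₁, hl₂, hl₃⟩ := hpos
  constructor
  · have hd := det_ne_zero_of_positive_combination hu₁ hu₂ hu₃ h₁₂ h₂₃ h₃₁ hl₃ hsum
    have e₁ : lam₁ * u₁.1 + lam₂ * u₂.1 + lam₃ * u₃.1 = 0 := congrArg Prod.fst hsum
    have e₂ : lam₁ * u₁.2 + lam₂ * u₂.2 + lam₃ * u₃.2 = 0 := congrArg Prod.snd hsum
    set c₁ := a₁.1 * u₁.1 + a₁.2 * u₁.2
    set c₂ := a₂.1 * u₂.1 + a₂.2 * u₂.2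
    set c₃ := a₃.1 * u₃.1 + a₃.2 * u₃.2
    refine (finite_setOf_abs_le hd (max c₁ ((lam₂ * c₂ + lam₃ * c₃) / lam₁))
      (max c₂ ((lam₁ * c₁ + lam₃ * c₃) / lam₂))).subset ?_
    rintro ⟨m, n⟩ ⟨⟨h₁, h₂⟩, h₃⟩
    simp only [shiftedHalfPlane, mem_ofPred_eq] at h₁ h₂ h₃ ⊢
    set f₁ := (m : ℝ) * u₁.1 + n * u₁.2
    set f₂ := (m : ℝ) * u₂.1 + n * u₂.2
    set f₃ := (m : ℝ) * u₃.1 + n * u₃.2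
    have g₁ : f₁ < c₁ := by linarith
    have g₂ : f₂ < c₂ := by linarith
    have g₃ : f₃ < c₃ := by linarith
    have hf : lam₁ * f₁ + lam₂ * f₂ + lam₃ * f₃ = 0 := by
      linear_combination (m : ℝ) * e₁ + (n : ℝ) * e₂
    have k₁ := mul_lt_mul_of_pos_left g₁ hl₁
    have k₂ := mul_lt_mul_of_pos_left g₂ hl₂
    have k₃ := mul_lt_mul_of_pos_left g₃ hl₃
    constructor <;> refine max_le_max ?_ ?_
    · exact g₁.le
    · rw [le_div_iff₀ hl₁]
      linarith
    · exact g₂.le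
    · rw [le_div_iff₀ hl₂]
      linarith
  · rintro ⟨hs₁, hs₂, hs₃⟩
    refine bsClosure_eq_self fun X hX x hx => ⟨⟨?_, ?_⟩, ?_⟩
    · exact mem_shiftedHalfPlane_of_isStableDir hs₁ a₁ hX fun y hy => (hx y hy).1.1
    · exact mem_shiftedHalfPlane_of_isStableDir hs₂ a₂ hX fun y hy => (hx y hy).1.2
    · exact mem_shiftedHalfPlane_of_isStableDir hs₃ a₃ hX fun y hy => (hx y hy).2
end
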